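/- arXiv:2506.02640 — 3 statements merged into one kernel-verified Lean document; each statement's English description precedes it below -/
import Mathlib

section
/- Let r ≥ 30 be a real number and let C^r be the Cantor dust with parameter r, with D_r = log 4 / log r. Then C^r is not Minkowski measurable: the function ε ↦ λ²((C^r)_ε) / ε^(2 − D_r) does not converge to a limit as ε → 0⁺; in fact its limit inferior as ε → 0⁺ is at most 5 + π, while its limit superior is at least (1 + 3·√(1/2) + π/2) / ((1/2)·(√2)^(log 4 / log r)), which is strictly greater than 5 + π. -/
open MeasureTheory Metric Set Real Filter Topology ENNReal

/-- The similarity map `x ↦ x/r + (a, b)` of the plane. -/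
noncomputable def cantorMap (r a b : ℝ) (x : EuclideanSpace ℝ (Fin 2)) :
    EuclideanSpace ℝ (Fin 2) :=
  r⁻¹ • x + (WithLp.equiv 2 (Fin 2 → ℝ)).symm ![a, b]

/-- `C` is the Cantor dust with parameter `r`: the (unique) nonempty compact set invariant
under the four similarities `S₁, S₂, S₃, S₄`. -/
def IsCantorDust (r : ℝ) (C : Set (EuclideanSpace ℝ (Fin 2))) : Prop :=
  IsCompact C ∧ C.Nonempty ∧
    C = cantorMap r 0 0 '' C ∪ cantorMap r ((r - 1) / r) 0 '' C ∪
        cantorMap r ((r - 1) / r) ((r - 1) / r) '' C ∪ cantorMap r 0 ((r - 1) / r) '' C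

theorem measureReal_union_four {α : Type*} [MeasurableSpace α] {μ : Measure α} {A B C D : Set α}
    (hAB : Disjoint A B) (hAC : Disjoint A C) (hAD : Disjoint A D) (hBC : Disjoint B C)
    (hBD : Disjoint B D) (hCD : Disjoint C D) (hB : MeasurableSet B) (hC : MeasurableSet C)
    (hD : MeasurableSet D) (hfin : μ (A ∪ B ∪ C ∪ D) ≠ ∞) :
    μ.real (A ∪ B ∪ C ∪ D) = μ.real A + μ.real B + μ.real C + μ.real D := by
  have h1 : μ (A ∪ B ∪ C) ≠ ∞ := measure_ne_top_of_subset subset_union_left hfin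
  have h2 : μ (A ∪ B) ≠ ∞ := measure_ne_top_of_subset subset_union_left h1
  rw [measureReal_union (by simp [hAD, hBD, hCD]) hD h1
      (measure_ne_top_of_subset subset_union_right hfin),
    measureReal_union (by simp [hAC, hBC]) hC h2
      (measure_ne_top_of_subset subset_union_right h1),
    measureReal_union hAB hB (measure_ne_top_of_subset subset_union_left h2)
      (measure_ne_top_of_subset subset_union_right h2)]

theorem cantorMap_apply_zero (r a b : ℝ) (x : EuclideanSpace ℝ (Fin 2)) :
    cantorMap r a b x 0 = r⁻¹ * x 0 + a := by
  simp [cantorMap]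

theorem cantorMap_apply_one (r a b : ℝ) (x : EuclideanSpace ℝ (Fin 2)) :
    cantorMap r a b x 1 = r⁻¹ * x 1 + b := by
  simp [cantorMap]

theorem dist_le_iff_sq {p q : EuclideanSpace ℝ (Fin 2)} {ε : ℝ} (hε : 0 ≤ ε) :
    dist p q ≤ ε ↔ (p 0 - q 0) ^ 2 + (p 1 - q 1) ^ 2 ≤ ε ^ 2 := by
  rw [EuclideanSpace.dist_eq, Real.sqrt_le_left hε]
  simp [Real.dist_eq, sq_abs]

theorem dist_lt_iff_sq {p q : EuclideanSpace ℝ (Fin 2)} {ε : ℝ} (hε : 0 < ε) :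
    dist p q < ε ↔ (p 0 - q 0) ^ 2 + (p 1 - q 1) ^ 2 < ε ^ 2 := by
  rw [EuclideanSpace.dist_eq, Real.sqrt_lt' hε]
  simp [Real.dist_eq, sq_abs]

theorem dist_cantorMap {r : ℝ} (hr : 0 < r) (a b : ℝ) (x y : EuclideanSpace ℝ (Fin 2)) :
    dist (cantorMap r a b x) (cantorMap r a b y) = r⁻¹ * dist x y := by
  simp [cantorMap, dist_smul₀, abs_of_pos hr]

theorem cantorMap_surjective {r : ℝ} (hr : 0 < r) (a b : ℝ) :
    Function.Surjective (cantorMap r a b) := fun y =>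
  ⟨r • (y - (WithLp.equiv 2 (Fin 2 → ℝ)).symm ![a, b]), by
    simp [cantorMap, smul_smul, inv_mul_cancel₀ hr.ne']⟩

theorem continuous_cantorMap (r a b : ℝ) : Continuous (cantorMap r a b) := by
  unfold cantorMap
  fun_prop

open scoped Pointwise in
theorem volume_real_image_cantorMap {r : ℝ} (hr : 0 < r) (a b : ℝ)
    (s : Set (EuclideanSpace ℝ (Fin 2))) :
    volume.real (cantorMap r a b '' s) = (r ^ 2)⁻¹ * volume.real s := by
  have h : cantorMap r a b '' s =
      (fun x => x + (WithLp.equiv 2 (Fin 2 → ℝ)).symm ![a, b]) '' (r⁻¹ • s) := by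
    rw [← image_smul, image_image]
    rfl
  rw [h, Measure.real, image_add_right, measure_preimage_add_right, Measure.addHaar_smul]
  simp [Measure.real, ENNReal.toReal_mul]
  left
  positivity

theorem cthickening_image_cantorMap {r : ℝ} (hr : 0 < r) (a b : ℝ)
    {s : Set (EuclideanSpace ℝ (Fin 2))} (hs : IsCompact s) {δ : ℝ} (hδ : 0 ≤ δ) :
    cthickening δ (cantorMap r a b '' s) = cantorMap r a b '' cthickening (r * δ) s := by
  rw [(hs.image (continuous_cantorMap r a b)).cthickening_eq_biUnion_closedBall hδ,
    hs.cthickening_eq_biUnion_closedBall (by positivity)]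
  ext p
  obtain ⟨q, rfl⟩ := cantorMap_surjective hr a b p
  have key (x : EuclideanSpace ℝ (Fin 2)) :
      dist (cantorMap r a b q) (cantorMap r a b x) ≤ δ ↔ dist q x ≤ r * δ := by
    rw [dist_cantorMap hr, inv_mul_le_iff₀ hr]
  have inj : Function.Injective (cantorMap r a b) := fun x y h => by
    have := dist_cantorMap hr a b x y
    rw [h, dist_self] at this
    have h2 : dist x y = 0 := by
      rcases mul_eq_zero.1 this.symm with h | h
      · exact absurd h (by positivity)
      · exact h
    exact dist_eq_zero.1 h2
  simp [inj.mem_set_image, key]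

namespace IsCantorDust

variable {r : ℝ} {C : Set (EuclideanSpace ℝ (Fin 2))}

theorem mem_Icc_of_coord (hr : 2 < r) (hC : IsCantorDust r C) (i : Fin 2)
    {p : EuclideanSpace ℝ (Fin 2)} (hp : p ∈ C) : p i ∈ Icc (0 : ℝ) 1 := by
  obtain ⟨hK, hne, hU⟩ := hC
  have hcont : ContinuousOn (fun p : EuclideanSpace ℝ (Fin 2) => p i) C := by fun_prop
  have hrinv : r⁻¹ < 1 := inv_lt_one_of_one_lt₀ (by linarith)
  have hdiv : (r - 1) / r = 1 - r⁻¹ := by field_simp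
  have hpre {x : EuclideanSpace ℝ (Fin 2)} (hx : x ∈ C) :
      ∃ q ∈ C, x i = r⁻¹ * q i ∨ x i = r⁻¹ * q i + (1 - r⁻¹) := by
    rw [hU] at hx
    rcases hx with ((⟨q, hq, rfl⟩ | ⟨q, hq, rfl⟩) | ⟨q, hq, rfl⟩) | ⟨q, hq, rfl⟩ <;>
      refine ⟨q, hq, ?_⟩ <;> fin_cases i <;>
      simp [cantorMap_apply_zero, cantorMap_apply_one, hdiv]
  have hpos : 0 < r⁻¹ := by positivity
  constructor
  · obtain ⟨x, hx, hmin⟩ := hK.exists_isMinOn hne hcont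
    obtain ⟨q, hq, h⟩ := hpre hx
    have h1 : x i ≤ q i := hmin hq
    have h2 : x i ≤ p i := hmin hp
    rcases h with h | h <;> nlinarith
  · obtain ⟨x, hx, hmax⟩ := hK.exists_isMaxOn hne hcont
    obtain ⟨q, hq, h⟩ := hpre hx
    have h1 : q i ≤ x i := hmax hq
    have h2 : p i ≤ x i := hmax hp
    rcases h with h | h <;> nlinarith

theorem mem_of_isFixedPt (hr : 2 < r) (hC : IsCantorDust r C) {a b : ℝ}
    (hmaps : MapsTo (cantorMap r a b) C C) {z : EuclideanSpace ℝ (Fin 2)}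
    (hz : cantorMap r a b z = z) : z ∈ C := by
  obtain ⟨hK, hne, -⟩ := hC
  obtain ⟨x, hx, hmin⟩ := hK.exists_isMinOn hne
    (f := fun x => dist x z) (by fun_prop)
  have h1 : dist x z ≤ dist (cantorMap r a b x) z := hmin (hmaps hx)
  have h2 := dist_cantorMap (show 0 < r by linarith) a b x z
  rw [hz] at h2
  have hrinv : r⁻¹ < 1 := inv_lt_one_of_one_lt₀ (by linarith)
  have h3 : dist x z = 0 := by nlinarith [dist_nonneg (x := x) (y := z)]
  rwa [← dist_eq_zero.1 h3]

theorem corners_mem (hr : 2 < r) (hC : IsCantorDust r C) :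
    !₂[0, 0] ∈ C ∧ !₂[1, 0] ∈ C ∧ !₂[1, 1] ∈ C ∧ !₂[0, 1] ∈ C := by
  have hr0 : r ≠ 0 := by linarith
  have hU := hC.2.2
  refine ⟨hC.mem_of_isFixedPt hr (a := 0) (b := 0) ?_ ?_,
    hC.mem_of_isFixedPt hr (a := (r - 1) / r) (b := 0) ?_ ?_,
    hC.mem_of_isFixedPt hr (a := (r - 1) / r) (b := (r - 1) / r) ?_ ?_,
    hC.mem_of_isFixedPt hr (a := 0) (b := (r - 1) / r) ?_ ?_⟩
  case refine_1 | refine_3 | refine_5 | refine_7 =>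
    intro x hx
    rw [hU]
    simp only [Set.mem_union, mem_image_of_mem _ hx, true_or, or_true]
  all_goals
    ext i
    fin_cases i <;> simp [cantorMap_apply_zero, cantorMap_apply_one] <;> field_simp <;> ring

theorem volume_real_cthickening_mul (hr : 30 ≤ r) (hC : IsCantorDust r C) {δ : ℝ} (hδ : 0 ≤ δ)
    (hδr : r * δ ≤ 1) :
    volume.real (cthickening (r * δ) C) = r ^ 2 / 4 * volume.real (cthickening δ C) := by
  have hr0 : 0 < r := by linarith
  have hδ' : δ ≤ 1 / 30 := by nlinarith
  have hdiv : (r - 1) / r = 1 - r⁻¹ := by field_simp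
  have hrinv : r⁻¹ ≤ 1 / 30 := by
    rw [inv_le_comm₀ hr0 (by norm_num)]; norm_num; exact hr
  have hrpos : 0 < r⁻¹ := by positivity
  have hbd {p : EuclideanSpace ℝ (Fin 2)} (hp : p ∈ cthickening (r * δ) C) (i : Fin 2) :
      -1 ≤ p i ∧ p i ≤ 2 := by
    rw [hC.1.cthickening_eq_biUnion_closedBall (by positivity)] at hp
    simp only [mem_iUnion, mem_closedBall, exists_prop] at hp
    obtain ⟨c, hc, hd⟩ := hp
    have h1 := hC.mem_Icc_of_coord (by linarith) i hc
    have h2 : |p i - c i| ≤ 1 := by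
      refine le_trans ?_ (hd.trans hδr)
      rw [dist_eq_norm]
      exact PiLp.norm_apply_le (p - c) i
    rw [abs_le] at h2
    constructor <;> linarith [h1.1, h1.2]
  have hmeas (a b : ℝ) : MeasurableSet (cantorMap r a b '' cthickening (r * δ) C) := by
    rw [← cthickening_image_cantorMap hr0 a b hC.1 hδ]
    exact isClosed_cthickening.measurableSet
  have hdec : cthickening δ C =
      cantorMap r 0 0 '' cthickening (r * δ) C ∪
        cantorMap r ((r - 1) / r) 0 '' cthickening (r * δ) C ∪
        cantorMap r ((r - 1) / r) ((r - 1) / r) '' cthickening (r * δ) C ∪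
        cantorMap r 0 ((r - 1) / r) '' cthickening (r * δ) C := by
    simp only [← cthickening_image_cantorMap hr0 _ _ hC.1 hδ]
    simp only [← cthickening_union]
    rw [← hC.2.2]
  have hd0 (a b a' b' : ℝ) (h : |a - a'| = 1 - r⁻¹ ∨ |b - b'| = 1 - r⁻¹) :
      Disjoint (cantorMap r a b '' cthickening (r * δ) C)
        (cantorMap r a' b' '' cthickening (r * δ) C) := by
    rw [Set.disjoint_left]
    rintro _ ⟨p, hp, rfl⟩ ⟨q, hq, hqp⟩
    have e0 := congrArg (fun x : EuclideanSpace ℝ (Fin 2) => x 0) hqp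
    have e1 := congrArg (fun x : EuclideanSpace ℝ (Fin 2) => x 1) hqp
    simp only [cantorMap_apply_zero, cantorMap_apply_one] at e0 e1
    have p0 := hbd hp 0
    have p1 := hbd hp 1
    have q0 := hbd hq 0
    have q1 := hbd hq 1
    rcases h with h | h
    · rw [show a - a' = r⁻¹ * (q 0 - p 0) by linarith, abs_mul, abs_of_pos hrpos] at h
      have : |q 0 - p 0| ≤ 3 := by rw [abs_le]; constructor <;> linarith
      nlinarith
    · rw [show b - b' = r⁻¹ * (q 1 - p 1) by linarith, abs_mul, abs_of_pos hrpos] at h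
      have : |q 1 - p 1| ≤ 3 := by rw [abs_le]; constructor <;> linarith
      nlinarith
  have habs : |1 - r⁻¹| = 1 - r⁻¹ := abs_of_nonneg (by linarith)
  have habs' : |r⁻¹ - 1| = 1 - r⁻¹ := by rw [abs_sub_comm, habs]
  have hvol : volume.real (cthickening δ C) =
      4 * ((r ^ 2)⁻¹ * volume.real (cthickening (r * δ) C)) := by
    have hfin : volume (cthickening δ C) ≠ ∞ := hC.1.cthickening.measure_lt_top.ne
    rw [hdec] at hfin ⊢
    rw [measureReal_union_four (hd0 _ _ _ _ ?_) (hd0 _ _ _ _ ?_) (hd0 _ _ _ _ ?_)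
      (hd0 _ _ _ _ ?_) (hd0 _ _ _ _ ?_) (hd0 _ _ _ _ ?_) (hmeas _ _) (hmeas _ _) (hmeas _ _) hfin]
    · simp only [volume_real_image_cantorMap hr0]
      ring
    all_goals simp [hdiv, habs, habs']
  rw [hvol]
  field_simp

end IsCantorDust

theorem volume_real_rectangle {a b c d : ℝ} (hab : a ≤ b) (hcd : c ≤ d) :
    volume.real {p : EuclideanSpace ℝ (Fin 2) | p 0 ∈ Icc a b ∧ p 1 ∈ Icc c d} =
      (b - a) * (d - c) := by
  have h : {p : EuclideanSpace ℝ (Fin 2) | p 0 ∈ Icc a b ∧ p 1 ∈ Icc c d} =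
      WithLp.ofLp ⁻¹' Icc ![a, c] ![b, d] := by
    ext p
    simp [Pi.le_def, Fin.forall_fin_two]
    tauto
  rw [h, Measure.real, (PiLp.volume_preserving_ofLp (Fin 2)).measure_preimage
    measurableSet_Icc.nullMeasurableSet, Real.volume_Icc_pi_toReal]
  · simp
  · simp [Pi.le_def, Fin.forall_fin_two, hab, hcd]

theorem volume_real_open_rectangle {a b c d : ℝ} (hab : a ≤ b) (hcd : c ≤ d) :
    volume.real {p : EuclideanSpace ℝ (Fin 2) | p 0 ∈ Ioo a b ∧ p 1 ∈ Ioo c d} =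
      (b - a) * (d - c) := by
  have h : {p : EuclideanSpace ℝ (Fin 2) | p 0 ∈ Ioo a b ∧ p 1 ∈ Ioo c d} =
      WithLp.ofLp ⁻¹' Set.pi univ fun i => Ioo (![a, c] i) (![b, d] i) := by
    ext p
    simp [Set.mem_pi, Fin.forall_fin_two]
  rw [h, Measure.real, (PiLp.volume_preserving_ofLp (Fin 2)).measure_preimage
    (MeasurableSet.univ_pi fun _ => measurableSet_Ioo).nullMeasurableSet,
    Real.volume_pi_Ioo_toReal]
  · simp
  · simp [Pi.le_def, Fin.forall_fin_two, hab, hcd]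

theorem volume_real_preimage_add_right (v : EuclideanSpace ℝ (Fin 2))
    (s : Set (EuclideanSpace ℝ (Fin 2))) : volume.real ((· + v) ⁻¹' s) = volume.real s := by
  rw [Measure.real, measure_preimage_add_right, Measure.real]

theorem volume_real_ball (x : EuclideanSpace ℝ (Fin 2)) {R : ℝ} (hR : 0 ≤ R) :
    volume.real (ball x R) = R ^ 2 * π := by
  rw [Measure.real, EuclideanSpace.volume_ball_fin_two, ENNReal.toReal_mul, ENNReal.toReal_pow,
    ENNReal.toReal_ofReal hR, ENNReal.toReal_ofReal pi_pos.le]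

theorem volume_real_segments_le {R : ℝ} (hR : 0 < R) (hR2 : R ^ 2 = 1 / 2) :
    1 + (volume.real (ball (0 : EuclideanSpace ℝ (Fin 2)) R ∩ {p | 1 / 2 ≤ p 0}) +
      volume.real (ball (0 : EuclideanSpace ℝ (Fin 2)) R ∩ {p | p 0 ≤ -(1 / 2)}) +
      volume.real (ball (0 : EuclideanSpace ℝ (Fin 2)) R ∩ {p | 1 / 2 ≤ p 1}) +
      volume.real (ball (0 : EuclideanSpace ℝ (Fin 2)) R ∩ {p | p 1 ≤ -(1 / 2)})) ≤ π / 2 := by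
  have hball (p : EuclideanSpace ℝ (Fin 2)) : p ∈ ball (0 : EuclideanSpace ℝ (Fin 2)) R ↔
      p 0 ^ 2 + p 1 ^ 2 < 1 / 2 := by
    rw [mem_ball, dist_lt_iff_sq hR, hR2]
    simp
  have hvol : volume.real (ball (0 : EuclideanSpace ℝ (Fin 2)) R) = π / 2 := by
    rw [volume_real_ball _ hR.le, hR2]
    ring
  have hm : MeasurableSet (ball (0 : EuclideanSpace ℝ (Fin 2)) R) := measurableSet_ball
  have hsq : volume.real {p : EuclideanSpace ℝ (Fin 2) | p 0 ∈ Ioo (-(1 / 2)) (1 / 2 : ℝ) ∧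
      p 1 ∈ Ioo (-(1 / 2)) (1 / 2 : ℝ)} = 1 := by
    rw [volume_real_open_rectangle] <;> norm_num
  have hfin : volume (ball (0 : EuclideanSpace ℝ (Fin 2)) R) ≠ ∞ := measure_ball_lt_top.ne
  have hsub : ball (0 : EuclideanSpace ℝ (Fin 2)) R ∩ {p | 1 / 2 ≤ p 0} ∪
      ball (0 : EuclideanSpace ℝ (Fin 2)) R ∩ {p | p 0 ≤ -(1 / 2)} ∪
      ball (0 : EuclideanSpace ℝ (Fin 2)) R ∩ {p | 1 / 2 ≤ p 1} ∪
      ball (0 : EuclideanSpace ℝ (Fin 2)) R ∩ {p | p 1 ≤ -(1 / 2)} ⊆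
      ball (0 : EuclideanSpace ℝ (Fin 2)) R := by
    simp only [union_subset_iff, inter_subset_left, and_self]
  have hfin' := measure_ne_top_of_subset hsub hfin
  have hm0 : Measurable fun p : EuclideanSpace ℝ (Fin 2) => p 0 := by fun_prop
  have hm1 : Measurable fun p : EuclideanSpace ℝ (Fin 2) => p 1 := by fun_prop
  rw [← measureReal_union_four _ _ _ _ _ _ (hm.inter (measurableSet_le hm0 measurable_const))
    (hm.inter (measurableSet_le measurable_const hm1))
    (hm.inter (measurableSet_le hm1 measurable_const)) hfin']
  · refine le_of_eq_of_le (congrArg (· + _) hsq.symm) ?_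
    rw [← measureReal_union' ?_ ?_ ?_ hfin', ← hvol]
    · refine measureReal_mono (union_subset ?_ hsub) hfin
      rintro p ⟨⟨h1, h2⟩, h3, h4⟩
      rw [hball]
      nlinarith
    · rw [Set.disjoint_left]
      rintro p ⟨⟨h1, h2⟩, h3, h4⟩
      simp only [Set.mem_union, mem_inter_iff, mem_ofPred_eq, not_or, not_and, not_le]
      exact ⟨⟨⟨fun _ => h2, fun _ => h1⟩, fun _ => h4⟩, fun _ => h3⟩
    · exact (hm0 measurableSet_Ioo).inter (hm1 measurableSet_Ioo)
    · refine measure_ne_top_of_subset ?_ hfin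
      rintro p ⟨⟨h1, h2⟩, h3, h4⟩
      rw [hball]
      nlinarith
  all_goals
    rw [Set.disjoint_left]
    rintro p ⟨h1, h2⟩ ⟨-, h3⟩
    rw [hball] at h1
    rw [mem_ofPred_eq] at h2 h3
    nlinarith

theorem two_add_pi_le_volume_real {R : ℝ} (hR : 0 < R) (hR2 : R ^ 2 = 1 / 2)
    {K : Set (EuclideanSpace ℝ (Fin 2))} (hK : volume K ≠ ∞) (h00 : ball !₂[0, 0] R ⊆ K)
    (h10 : ball !₂[1, 0] R ⊆ K) (h11 : ball !₂[1, 1] R ⊆ K) (h01 : ball !₂[0, 1] R ⊆ K) :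
    2 + π ≤ volume.real K := by
  have hseg := volume_real_segments_le hR hR2
  have hvol : volume.real (ball (0 : EuclideanSpace ℝ (Fin 2)) R) = π / 2 := by
    rw [volume_real_ball _ hR.le, hR2]
    ring
  have hfin : volume (ball (0 : EuclideanSpace ℝ (Fin 2)) R) ≠ ∞ := measure_ball_lt_top.ne
  have hm0 : Measurable fun p : EuclideanSpace ℝ (Fin 2) => p 0 := by fun_prop
  have hm1 : Measurable fun p : EuclideanSpace ℝ (Fin 2) => p 1 := by fun_prop
  have piece (c : EuclideanSpace ℝ (Fin 2)) (P H H' : Set (EuclideanSpace ℝ (Fin 2)))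
      (hP : ∀ p, p ∉ H → p ∉ H' → p + c ∈ P) :
      π / 2 ≤ volume.real (ball c R ∩ P) + volume.real (ball 0 R ∩ H) +
        volume.real (ball 0 R ∩ H') := by
    have hpre : (· + c) ⁻¹' (ball c R ∩ P) = ball 0 R ∩ (· + c) ⁻¹' P := by
      ext p
      simp
    rw [← volume_real_preimage_add_right c, hpre, ← hvol]
    refine (measureReal_mono ?_ ?_).trans
      ((measureReal_union_le _ _).trans (add_le_add_left (measureReal_union_le _ _) _))
    · intro p hp
      by_cases h1 : p ∈ H
      · exact Or.inl (Or.inr ⟨hp, h1⟩)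
      by_cases h2 : p ∈ H'
      · exact Or.inr ⟨hp, h2⟩
      · exact Or.inl (Or.inl ⟨hp, hP p h1 h2⟩)
    · exact measure_ne_top_of_subset (by simp only [union_subset_iff, inter_subset_left, and_self])
        hfin
  have q00 := piece !₂[0, 0] {p | p 0 < 1 / 2 ∧ p 1 < 1 / 2} {p | 1 / 2 ≤ p 0} {p | 1 / 2 ≤ p 1}
  have q10 := piece !₂[1, 0] {p | 1 / 2 < p 0 ∧ p 1 < 1 / 2} {p | p 0 ≤ -(1 / 2)} {p | 1 / 2 ≤ p 1}
  have q11 := piece !₂[1, 1] {p | 1 / 2 < p 0 ∧ 1 / 2 < p 1} {p | p 0 ≤ -(1 / 2)}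
    {p | p 1 ≤ -(1 / 2)}
  have q01 := piece !₂[0, 1] {p | p 0 < 1 / 2 ∧ 1 / 2 < p 1} {p | 1 / 2 ≤ p 0}
    {p | p 1 ≤ -(1 / 2)}
  simp only [mem_ofPred_eq, not_le, PiLp.add_apply, Matrix.cons_val_zero,
    Matrix.cons_val_one] at q00 q10 q11 q01
  replace q00 := q00 fun p h h' => by constructor <;> linarith
  replace q10 := q10 fun p h h' => by constructor <;> linarith
  replace q11 := q11 fun p h h' => by constructor <;> linarith
  replace q01 := q01 fun p h h' => by constructor <;> linarith
  have hsub := union_subset (union_subset (union_subset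
    ((inter_subset_left (t := {p | p 0 < 1 / 2 ∧ p 1 < 1 / 2})).trans h00)
    ((inter_subset_left (t := {p | 1 / 2 < p 0 ∧ p 1 < 1 / 2})).trans h10))
    ((inter_subset_left (t := {p | 1 / 2 < p 0 ∧ 1 / 2 < p 1})).trans h11))
    ((inter_subset_left (t := {p | p 0 < 1 / 2 ∧ 1 / 2 < p 1})).trans h01)
  have hle := measureReal_mono hsub hK
  rw [measureReal_union_four ?_ ?_ ?_ ?_ ?_ ?_ ?_ ?_ ?_
    (measure_ne_top_of_subset hsub hK)] at hle
  · linarith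
  rotate_left 6
  · exact measurableSet_ball.inter ((measurableSet_lt measurable_const hm0).inter
      (measurableSet_lt hm1 measurable_const))
  · exact measurableSet_ball.inter ((measurableSet_lt measurable_const hm0).inter
      (measurableSet_lt measurable_const hm1))
  · exact measurableSet_ball.inter ((measurableSet_lt hm0 measurable_const).inter
      (measurableSet_lt measurable_const hm1))
  all_goals
    rw [Set.disjoint_left]
    rintro p ⟨-, h1, h2⟩ ⟨-, h3, h4⟩
    linarith

theorem volume_real_le_five_add_pi {K : Set (EuclideanSpace ℝ (Fin 2))}
    (hK : ∀ p ∈ K, ∃ c : EuclideanSpace ℝ (Fin 2),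
      c 0 ∈ Icc (0 : ℝ) 1 ∧ c 1 ∈ Icc (0 : ℝ) 1 ∧ dist p c ≤ 1) :
    volume.real K ≤ 5 + π := by
  have hm0 : Measurable fun p : EuclideanSpace ℝ (Fin 2) => p 0 := by fun_prop
  have hm1 : Measurable fun p : EuclideanSpace ℝ (Fin 2) => p 1 := by fun_prop
  have hvol : volume.real (closedBall (0 : EuclideanSpace ℝ (Fin 2)) 1) = π := by
    rw [Measure.real, EuclideanSpace.volume_closedBall_fin_two]
    simp [pi_pos.le]
  have hfin : volume (closedBall (0 : EuclideanSpace ℝ (Fin 2)) 1) ≠ ∞ :=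
    measure_closedBall_lt_top.ne
  have hsub := union_subset (union_subset (union_subset
    (inter_subset_left (s := closedBall (0 : EuclideanSpace ℝ (Fin 2)) 1)
      (t := {p | p 0 < 0 ∧ p 1 < 0}))
    (inter_subset_left (t := {p | 0 < p 0 ∧ p 1 < 0})))
    (inter_subset_left (t := {p | 0 < p 0 ∧ 0 < p 1})))
    (inter_subset_left (t := {p | p 0 < 0 ∧ 0 < p 1}))
  have hquad := measureReal_mono hsub hfin
  rw [hvol, measureReal_union_four ?_ ?_ ?_ ?_ ?_ ?_ ?_ ?_ ?_
    (measure_ne_top_of_subset hsub hfin)] at hquad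
  rotate_left
  iterate 6
    · rw [Set.disjoint_left]
      rintro p ⟨-, h1, h2⟩ ⟨-, h3, h4⟩
      linarith
  · exact measurableSet_closedBall.inter ((measurableSet_lt measurable_const hm0).inter
      (measurableSet_lt hm1 measurable_const))
  · exact measurableSet_closedBall.inter ((measurableSet_lt measurable_const hm0).inter
      (measurableSet_lt measurable_const hm1))
  · exact measurableSet_closedBall.inter ((measurableSet_lt hm0 measurable_const).inter
      (measurableSet_lt measurable_const hm1))
  set Q00 := closedBall (0 : EuclideanSpace ℝ (Fin 2)) 1 ∩ {p | p 0 < 0 ∧ p 1 < 0}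
  set Q10 := closedBall (0 : EuclideanSpace ℝ (Fin 2)) 1 ∩ {p | 0 < p 0 ∧ p 1 < 0}
  set Q11 := closedBall (0 : EuclideanSpace ℝ (Fin 2)) 1 ∩ {p | 0 < p 0 ∧ 0 < p 1}
  set Q01 := closedBall (0 : EuclideanSpace ℝ (Fin 2)) 1 ∩ {p | p 0 < 0 ∧ 0 < p 1}
  have hv0 : volume.real {p : EuclideanSpace ℝ (Fin 2) | p 0 ∈ Icc (0 : ℝ) 1 ∧
      p 1 ∈ Icc (-1 : ℝ) 2} = 3 := by rw [volume_real_rectangle] <;> norm_num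
  have hv1 : volume.real {p : EuclideanSpace ℝ (Fin 2) | p 0 ∈ Icc (-1 : ℝ) 0 ∧
      p 1 ∈ Icc (0 : ℝ) 1} = 1 := by rw [volume_real_rectangle] <;> norm_num
  have hv2 : volume.real {p : EuclideanSpace ℝ (Fin 2) | p 0 ∈ Icc (1 : ℝ) 2 ∧
      p 1 ∈ Icc (0 : ℝ) 1} = 1 := by rw [volume_real_rectangle] <;> norm_num
  set R0 := {p : EuclideanSpace ℝ (Fin 2) | p 0 ∈ Icc (0 : ℝ) 1 ∧ p 1 ∈ Icc (-1 : ℝ) 2} with hR0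
  set R1 := {p : EuclideanSpace ℝ (Fin 2) | p 0 ∈ Icc (-1 : ℝ) 0 ∧ p 1 ∈ Icc (0 : ℝ) 1} with hR1
  set R2 := {p : EuclideanSpace ℝ (Fin 2) | p 0 ∈ Icc (1 : ℝ) 2 ∧ p 1 ∈ Icc (0 : ℝ) 1} with hR2
  have hcover : K ⊆ R0 ∪ (R1 ∪ (R2 ∪ (Q00 ∪ ((· + !₂[-1, 0]) ⁻¹' Q10 ∪
      ((· + !₂[-1, -1]) ⁻¹' Q11 ∪ (· + !₂[0, -1]) ⁻¹' Q01))))) := by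
    intro p hp
    obtain ⟨c, ⟨hc0, hc0'⟩, ⟨hc1, hc1'⟩, hd⟩ := hK p hp
    rw [dist_le_iff_sq zero_le_one] at hd
    simp only [hR0, hR1, hR2, Q00, Q10, Q11, Q01, Set.mem_union, mem_ofPred_eq, mem_preimage,
      mem_inter_iff, mem_closedBall, dist_le_iff_sq zero_le_one, PiLp.add_apply,
      Matrix.cons_val_zero, Matrix.cons_val_one, PiLp.zero_apply, sub_zero, mem_Icc]
    have a1 : |p 0 - c 0| ≤ 1 := abs_le_of_sq_le_sq (by nlinarith) zero_le_one
    have a2 : |p 1 - c 1| ≤ 1 := abs_le_of_sq_le_sq (by nlinarith) zero_le_one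
    rw [abs_le] at a1 a2
    rcases lt_or_ge (p 0) 0 with h0 | h0
    · rcases lt_or_ge (p 1) 0 with h1 | h1
      · exact Or.inr (Or.inr (Or.inr (Or.inl ⟨by nlinarith, h0, h1⟩)))
      rcases lt_or_ge 1 (p 1) with h2 | h2
      · exact Or.inr (Or.inr (Or.inr (Or.inr (Or.inr (Or.inr
          ⟨by nlinarith, by linarith, by linarith⟩)))))
      · exact Or.inr (Or.inl ⟨⟨by linarith, h0.le⟩, h1, h2⟩)
    rcases lt_or_ge 1 (p 0) with h0' | h0'
    · rcases lt_or_ge (p 1) 0 with h1 | h1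
      · exact Or.inr (Or.inr (Or.inr (Or.inr (Or.inl ⟨by nlinarith, by linarith, by linarith⟩))))
      rcases lt_or_ge 1 (p 1) with h2 | h2
      · exact Or.inr (Or.inr (Or.inr (Or.inr (Or.inr (Or.inl
          ⟨by nlinarith, by linarith, by linarith⟩)))))
      · exact Or.inr (Or.inr (Or.inl ⟨⟨h0'.le, by linarith⟩, h1, h2⟩))
    · exact Or.inl ⟨⟨h0, h0'⟩, by linarith, by linarith⟩
  have t1 := volume_real_preimage_add_right !₂[-1, 0] Q10
  have t2 := volume_real_preimage_add_right !₂[-1, -1] Q11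
  have t3 := volume_real_preimage_add_right !₂[0, -1] Q01
  have nt {A : Set (EuclideanSpace ℝ (Fin 2))} (h : volume.real A = 3 ∨ volume.real A = 1) :
      volume A ≠ ∞ := by
    intro hA
    simp [Measure.real, hA] at h
  have ntQ {P : Set (EuclideanSpace ℝ (Fin 2))} :
      volume (closedBall (0 : EuclideanSpace ℝ (Fin 2)) 1 ∩ P) ≠ ∞ :=
    measure_ne_top_of_subset inter_subset_left hfin
  have hle := measureReal_mono (μ := volume) hcover (by
    simp only [ne_eq, measure_union_eq_top_iff, measure_preimage_add_right, not_or]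
    exact ⟨nt (Or.inl hv0), nt (Or.inr hv1), nt (Or.inr hv2), ntQ, ntQ, ntQ, ntQ⟩)
  have u1 := (measureReal_union_le (μ := volume) _ _).trans' hle
  have u2 := measureReal_union_le (μ := volume) R1 (R2 ∪ (Q00 ∪ ((· + !₂[-1, 0]) ⁻¹' Q10 ∪
      ((· + !₂[-1, -1]) ⁻¹' Q11 ∪ (· + !₂[0, -1]) ⁻¹' Q01))))
  have u3 := measureReal_union_le (μ := volume) R2 (Q00 ∪ ((· + !₂[-1, 0]) ⁻¹' Q10 ∪
      ((· + !₂[-1, -1]) ⁻¹' Q11 ∪ (· + !₂[0, -1]) ⁻¹' Q01)))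
  have u4 := measureReal_union_le (μ := volume) Q00 ((· + !₂[-1, 0]) ⁻¹' Q10 ∪
      ((· + !₂[-1, -1]) ⁻¹' Q11 ∪ (· + !₂[0, -1]) ⁻¹' Q01))
  have u5 := measureReal_union_le (μ := volume) ((· + !₂[-1, 0]) ⁻¹' Q10)
      ((· + !₂[-1, -1]) ⁻¹' Q11 ∪ (· + !₂[0, -1]) ⁻¹' Q01)
  have u6 := measureReal_union_le (μ := volume) ((· + !₂[-1, -1]) ⁻¹' Q11)
    ((· + !₂[0, -1]) ⁻¹' Q01)
  linarith

namespace IsCantorDust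

variable {r : ℝ} {C : Set (EuclideanSpace ℝ (Fin 2))}

theorem volume_real_cthickening_one_le (hr : 2 < r) (hC : IsCantorDust r C) :
    volume.real (cthickening 1 C) ≤ 5 + π := by
  refine volume_real_le_five_add_pi fun p hp => ?_
  rw [hC.1.cthickening_eq_biUnion_closedBall zero_le_one] at hp
  simp only [mem_iUnion, mem_closedBall, exists_prop] at hp
  obtain ⟨c, hc, hd⟩ := hp
  exact ⟨c, hC.mem_Icc_of_coord hr 0 hc, hC.mem_Icc_of_coord hr 1 hc, hd⟩

theorem two_add_pi_le_volume_real_cthickening (hr : 2 < r) (hC : IsCantorDust r C) :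
    2 + π ≤ volume.real (cthickening (√(1 / 2)) C) := by
  obtain ⟨h00, h10, h11, h01⟩ := hC.corners_mem hr
  have hsub {c : EuclideanSpace ℝ (Fin 2)} (hc : c ∈ C) :
      ball c (√(1 / 2)) ⊆ cthickening (√(1 / 2)) C := fun p hp =>
    mem_cthickening_of_dist_le p c _ C hc (mem_ball.1 hp).le
  exact two_add_pi_le_volume_real (by positivity) (Real.sq_sqrt (by norm_num))
    hC.1.cthickening.measure_lt_top.ne (hsub h00) (hsub h10) (hsub h11) (hsub h01)

theorem volume_div_rpow_mul (hr : 30 ≤ r) (hC : IsCantorDust r C) {δ : ℝ} (hδ : 0 < δ)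
    (hδr : r * δ ≤ 1) :
    (volume (cthickening (r * δ) C)).toReal / (r * δ) ^ (2 - Real.log 4 / Real.log r) =
      (volume (cthickening δ C)).toReal / δ ^ (2 - Real.log 4 / Real.log r) := by
  have hr0 : 0 < r := by linarith
  have hlog : Real.log r ≠ 0 := (Real.log_pos (by linarith)).ne'
  have hpow : r ^ (2 - Real.log 4 / Real.log r) = r ^ 2 / 4 := by
    rw [Real.rpow_sub hr0, Real.rpow_two, Real.rpow_def_of_pos hr0,
      mul_div_cancel₀ _ hlog, Real.exp_log (by norm_num)]
  have h := hC.volume_real_cthickening_mul hr hδ.le hδr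
  rw [Measure.real, Measure.real] at h
  rw [h, Real.mul_rpow hr0.le hδ.le, hpow, mul_div_mul_left _ _ (by positivity)]

theorem volume_div_rpow_pow_mul (hr : 30 ≤ r) (hC : IsCantorDust r C) (n : ℕ) {δ : ℝ}
    (hδ : 0 < δ) (hδr : r ^ n * δ ≤ 1) :
    (volume (cthickening (r ^ n * δ) C)).toReal /
        (r ^ n * δ) ^ (2 - Real.log 4 / Real.log r) =
      (volume (cthickening δ C)).toReal / δ ^ (2 - Real.log 4 / Real.log r) := by
  have hr0 : 0 < r := by linarith
  induction n with
  | zero => simp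
  | succ n ih =>
    rw [pow_succ', mul_assoc] at hδr ⊢
    rw [hC.volume_div_rpow_mul hr (by positivity) hδr, ih]
    have : 0 < r ^ n * δ := by positivity
    nlinarith

theorem frequently_volume_div_rpow (hr : 30 ≤ r) (hC : IsCantorDust r C) {P : ℝ → Prop} {ε : ℝ}
    (hε : 0 < ε) (hε1 : ε ≤ 1)
    (hP : P ((volume (cthickening ε C)).toReal / ε ^ (2 - Real.log 4 / Real.log r))) :
    ∃ᶠ δ in 𝓝[>] (0 : ℝ),
      P ((volume (cthickening δ C)).toReal / δ ^ (2 - Real.log 4 / Real.log r)) := by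
  have hr0 : 0 < r := by linarith
  have hlim : Tendsto (fun n : ℕ => ε / r ^ n) atTop (𝓝[>] 0) := by
    refine tendsto_nhdsWithin_iff.2 ⟨?_, Eventually.of_forall fun n => ?_⟩
    · exact tendsto_const_nhds.div_atTop (tendsto_pow_atTop_atTop_of_one_lt (by linarith))
    · exact div_pos hε (by positivity)
  refine hlim.frequently (Eventually.of_forall fun n => ?_).frequently
  have hmul : r ^ n * (ε / r ^ n) = ε := mul_div_cancel₀ _ (by positivity)
  have h := hC.volume_div_rpow_pow_mul hr n (δ := ε / r ^ n) (by positivity) (by rwa [hmul])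
  rw [hmul] at h
  rwa [← h]

theorem log_four_div_log_le (hr : 30 ≤ r) : Real.log 4 / Real.log r ≤ 20 / 49 := by
  have hlog : 0 < Real.log r := Real.log_pos (by linarith)
  have h30 : Real.log 30 ≤ Real.log r := Real.log_le_log (by norm_num) hr
  have h4 : Real.log 4 = 2 * Real.log 2 := by
    rw [show (4 : ℝ) = 2 ^ 2 by norm_num, Real.log_pow]
    norm_num
  have h : 49 * Real.log 2 ≤ 10 * Real.log 30 := by
    have h' : Real.log ((2 : ℝ) ^ 49) ≤ Real.log ((30 : ℝ) ^ 10) :=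
      Real.log_le_log (by norm_num) (by norm_num)
    simpa [Real.log_pow] using h'
  rw [div_le_iff₀ hlog]
  linarith

theorem isBoundedUnder_volume_div_rpow (hr : 30 ≤ r) (hC : IsCantorDust r C) :
    IsBoundedUnder (· ≤ ·) (𝓝[>] (0 : ℝ)) fun ε =>
      (volume (cthickening ε C)).toReal / ε ^ (2 - Real.log 4 / Real.log r) := by
  have hr0 : 0 < r := by linarith
  have hD := log_four_div_log_le hr
  refine ⟨(5 + π) / r⁻¹ ^ (2 - Real.log 4 / Real.log r), ?_⟩
  rw [eventually_map]
  filter_upwards [Ioc_mem_nhdsGT zero_lt_one] with ε hε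
  obtain ⟨n, hn, hn'⟩ := exists_nat_pow_near (x := ε⁻¹) ((one_le_inv₀ hε.1).2 hε.2)
    (show 1 < r by linarith)
  have h1 : r ^ n * ε ≤ 1 := by
    rwa [← le_div_iff₀ hε.1, one_div]
  have h2 : r⁻¹ ≤ r ^ n * ε := by
    rw [inv_lt_iff_one_lt_mul₀ hε.1, pow_succ'] at hn'
    rw [inv_le_iff_one_le_mul₀' hr0]
    linarith
  rw [← hC.volume_div_rpow_pow_mul hr n hε.1 h1]
  have h3 : (volume (cthickening (r ^ n * ε) C)).toReal ≤ 5 + π :=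
    (measureReal_mono (cthickening_mono h1 C) hC.1.cthickening.measure_lt_top.ne).trans
      (hC.volume_real_cthickening_one_le (by linarith))
  exact div_le_div₀ (by positivity) h3 (by positivity)
    (Real.rpow_le_rpow (by positivity) h2 (by linarith))

end IsCantorDust

theorem five_add_pi_lt {r : ℝ} (hr : 30 ≤ r) :
    5 + π < (1 + 3 * √(1 / 2) + π / 2) / (1 / 2 * √2 ^ (Real.log 4 / Real.log r)) := by
  have hpow : √2 ^ (Real.log 4 / Real.log r) ≤ 1.1525 := by
    have h2 : (1 : ℝ) ≤ √2 := by rw [Real.one_le_sqrt]; norm_num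
    refine (Real.rpow_le_rpow_of_exponent_le h2 (IsCantorDust.log_four_div_log_le hr)).trans ?_
    rw [Real.sqrt_eq_rpow, ← Real.rpow_mul (by norm_num),
      show (1 / 2 : ℝ) * (20 / 49) = 10 * (49 : ℝ)⁻¹ by norm_num, Real.rpow_mul (by norm_num),
      Real.rpow_inv_le_iff_of_pos (by positivity) (by norm_num) (by norm_num)]
    norm_num [← Real.rpow_natCast]
  have hs : 0.7071 < √(1 / 2) := by
    rw [Real.lt_sqrt (by norm_num)]
    norm_num
  have hpi := pi_lt_d4
  rw [lt_div_iff₀ (by positivity)]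
  nlinarith [pi_pos]

/-- For `r ≥ 30` the Cantor dust `C^r` is not Minkowski measurable: the liminf of
`ε ↦ λ²((C^r)_ε) / ε^(2 - D_r)` as `ε → 0⁺` is at most `5 + π`, the limsup is at least
`(1 + 3√(1/2) + π/2) / ((1/2)·(√2)^(log 4 / log r))`, the latter bound is strictly larger
than `5 + π`, and the function has no limit as `ε → 0⁺`. -/
theorem stmt_0 (r : ℝ) (hr : 30 ≤ r) (C : Set (EuclideanSpace ℝ (Fin 2)))
    (hC : IsCantorDust r C) :
    Filter.liminf
        (fun ε : ℝ => (volume (cthickening ε C)).toReal / ε ^ (2 - Real.log 4 / Real.log r))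
        (𝓝[>] 0) ≤ 5 + π ∧
    (1 + 3 * Real.sqrt (1 / 2) + π / 2) / (1 / 2 * Real.sqrt 2 ^ (Real.log 4 / Real.log r)) ≤
      Filter.limsup
        (fun ε : ℝ => (volume (cthickening ε C)).toReal / ε ^ (2 - Real.log 4 / Real.log r))
        (𝓝[>] 0) ∧
    5 + π <
      (1 + 3 * Real.sqrt (1 / 2) + π / 2) / (1 / 2 * Real.sqrt 2 ^ (Real.log 4 / Real.log r)) ∧
    ¬ ∃ L : ℝ, Filter.Tendsto
        (fun ε : ℝ => (volume (cthickening ε C)).toReal / ε ^ (2 - Real.log 4 / Real.log r))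
        (𝓝[>] 0) (𝓝 L) := by
  have hr2 : 2 < r := by linarith
  have hs : 0 < √(1 / 2) := by positivity
  have hs1 : √(1 / 2) ≤ 1 := Real.sqrt_le_one.2 (by norm_num)
  have hlow : ∃ᶠ ε in 𝓝[>] (0 : ℝ),
      (volume (cthickening ε C)).toReal / ε ^ (2 - Real.log 4 / Real.log r) ≤ 5 + π := by
    refine hC.frequently_volume_div_rpow (P := (· ≤ 5 + π)) hr one_pos le_rfl ?_
    rw [Real.one_rpow, div_one]
    exact hC.volume_real_cthickening_one_le hr2
  have hhigh : ∃ᶠ ε in 𝓝[>] (0 : ℝ),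
      (1 + 3 * √(1 / 2) + π / 2) / (1 / 2 * √2 ^ (Real.log 4 / Real.log r)) ≤
        (volume (cthickening ε C)).toReal / ε ^ (2 - Real.log 4 / Real.log r) := by
    refine hC.frequently_volume_div_rpow (P := fun y =>
      (1 + 3 * √(1 / 2) + π / 2) / (1 / 2 * √2 ^ (Real.log 4 / Real.log r)) ≤ y) hr hs hs1 ?_
    have hden : √(1 / 2) ^ (2 - Real.log 4 / Real.log r) =
        1 / 2 * √2 ^ (Real.log 4 / Real.log r) := by
      rw [Real.rpow_sub hs, Real.rpow_two, Real.sq_sqrt (by norm_num), one_div, Real.sqrt_inv,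
        Real.inv_rpow (by positivity), div_inv_eq_mul]
    rw [hden]
    refine div_le_div_of_nonneg_right ?_ (by positivity)
    refine le_trans ?_ (hC.two_add_pi_le_volume_real_cthickening hr2)
    have : √(1 / 2) < 0.75 := by
      rw [Real.sqrt_lt' (by norm_num)]
      norm_num
    linarith [pi_gt_three]
  have hgap := five_add_pi_lt hr
  have hbdd := hC.isBoundedUnder_volume_div_rpow hr
  have hbdd' : IsBoundedUnder (· ≥ ·) (𝓝[>] (0 : ℝ)) fun ε =>
      (volume (cthickening ε C)).toReal / ε ^ (2 - Real.log 4 / Real.log r) := by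
    refine ⟨0, ?_⟩
    rw [eventually_map]
    filter_upwards [self_mem_nhdsWithin] with ε hε
    exact div_nonneg ENNReal.toReal_nonneg (Real.rpow_nonneg (le_of_lt hε) _)
  have h1 := liminf_le_of_frequently_le hlow hbdd'
  have h2 := le_limsup_of_frequently_le hhigh hbdd
  refine ⟨h1, h2, hgap, ?_⟩
  rintro ⟨L, hL⟩
  rw [hL.liminf_eq] at h1
  rw [hL.limsup_eq] at h2
  linarith
end

section
/- Let r > 2 and let Γ = (0,1)² \ (S₁((0,1)²) ∪ S₂((0,1)²) ∪ S₃((0,1)²) ∪ S₄((0,1)²)). Then for every ε > 0, the set (C^r)_ε ∩ Γ has strictly positive Lebesgue measure: λ²((C^r)_ε ∩ Γ) > 0. -/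
open MeasureTheory Metric Set Real Filter Topology ENNReal

/-- The open unit square `(0,1)²`. -/
def openSquare : Set (EuclideanSpace ℝ (Fin 2)) :=
  {x | 0 < x 0 ∧ x 0 < 1 ∧ 0 < x 1 ∧ x 1 < 1}

/-- `Γ = (0,1)² \ (S₁((0,1)²) ∪ S₂((0,1)²) ∪ S₃((0,1)²) ∪ S₄((0,1)²))`. -/
noncomputable def Gamma (r : ℝ) : Set (EuclideanSpace ℝ (Fin 2)) :=
  openSquare \
    (cantorMap r 0 0 '' openSquare ∪ cantorMap r ((r - 1) / r) 0 '' openSquare ∪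
     cantorMap r ((r - 1) / r) ((r - 1) / r) '' openSquare ∪
     cantorMap r 0 ((r - 1) / r) '' openSquare)

/-- The fixed point of a contraction `cantorMap r a b` lies in every nonempty closed set that the
map preserves. -/
theorem mem_of_cantorMap_fixed {r a b : ℝ} (hr : 1 < r) {C : Set (EuclideanSpace ℝ (Fin 2))}
    (hC : IsClosed C) (hne : C.Nonempty) (hmaps : MapsTo (cantorMap r a b) C C)
    {p : EuclideanSpace ℝ (Fin 2)} (hp : cantorMap r a b p = p) : p ∈ C := by
  obtain ⟨x, hx⟩ := hne
  have hiter : ∀ n : ℕ, (cantorMap r a b)^[n] x = p + (r⁻¹) ^ n • (x - p) := by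
    intro n
    induction n with
    | zero => simp
    | succ n ih =>
      rw [Function.iterate_succ_apply', ih]
      nth_rewrite 3 [← hp]
      simp only [cantorMap, smul_add, smul_smul, pow_succ']
      abel
  have hlim : Tendsto (fun n : ℕ => (cantorMap r a b)^[n] x) atTop (𝓝 p) := by
    have h := (tendsto_pow_atTop_nhds_zero_of_lt_one (inv_nonneg.2 (by linarith))
      (inv_lt_one_of_one_lt₀ hr)).smul_const (x - p)
    simpa [hiter] using h.const_add p
  exact hC.mem_of_tendsto hlim (Eventually.of_forall fun n => hmaps.iterate n hx)

/-- The corner `(1/r, 0)` of the lower left subsquare belongs to the Cantor dust. -/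
theorem IsCantorDust.corner_mem {r : ℝ} (hr : 2 < r) {C : Set (EuclideanSpace ℝ (Fin 2))}
    (hC : IsCantorDust r C) : !₂[r⁻¹, 0] ∈ C := by
  obtain ⟨hcomp, hne, heq⟩ := hC
  have hr0 : r ≠ 0 := by positivity
  have h₁ : MapsTo (cantorMap r 0 0) C C := fun x hx => by
    rw [heq]; exact Or.inl (Or.inl (Or.inl ⟨x, hx, rfl⟩))
  have h₂ : MapsTo (cantorMap r ((r - 1) / r) 0) C C := fun x hx => by
    rw [heq]; exact Or.inl (Or.inl (Or.inr ⟨x, hx, rfl⟩))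
  have hmem : !₂[(1 : ℝ), 0] ∈ C := by
    refine mem_of_cantorMap_fixed (by linarith) hcomp.isClosed hne h₂ ?_
    ext i
    fin_cases i
    · simp [cantorMap]; field_simp; ring
    · simp [cantorMap]
  convert h₁ hmem using 1
  ext i
  fin_cases i <;> simp [cantorMap]

/-- The part of the unit square strictly between the left and the right subsquares lies in `Γ`. -/
theorem mem_Gamma {r : ℝ} (hr : 2 < r) {x : EuclideanSpace ℝ (Fin 2)} (h₁ : r⁻¹ < x 0)
    (h₂ : x 0 < 1 - r⁻¹) (h₃ : 0 < x 1) (h₄ : x 1 < 1) : x ∈ _root_.Gamma r := by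
  have hpos : 0 < r⁻¹ := by positivity
  have hdiv : (r - 1) / r = 1 - r⁻¹ := by field_simp
  refine ⟨⟨by linarith, by linarith, h₃, h₄⟩, ?_⟩
  rintro (((⟨y, ⟨hy₀, hy₁, -⟩, rfl⟩ | ⟨y, ⟨hy₀, hy₁, -⟩, rfl⟩) | ⟨y, ⟨hy₀, hy₁, -⟩, rfl⟩) |
    ⟨y, ⟨hy₀, hy₁, -⟩, rfl⟩) <;>
  · simp [cantorMap, hdiv] at h₁ h₂
    nlinarith [mul_pos hpos hy₀, mul_pos hpos (sub_pos.2 hy₁)]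

/-- For `r > 2` and every `ε > 0`, the set `(C^r)_ε ∩ Γ` has strictly positive
Lebesgue measure. -/
theorem stmt_4 (r : ℝ) (hr : 2 < r) (C : Set (EuclideanSpace ℝ (Fin 2)))
    (hC : IsCantorDust r C) (ε : ℝ) (hε : 0 < ε) :
    0 < volume (cthickening ε C ∩ Gamma r) := by
  have hinv : r⁻¹ < 1 / 2 := by
    rw [one_div]
    exact inv_strictAnti₀ two_pos hr
  set p : EuclideanSpace ℝ (Fin 2) := !₂[r⁻¹, 0] with hp
  let U : Set (EuclideanSpace ℝ (Fin 2)) :=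
    ball p ε ∩ {x | r⁻¹ < x 0 ∧ x 0 < 1 - r⁻¹ ∧ 0 < x 1 ∧ x 1 < 1}
  have hsub : U ⊆ cthickening ε C ∩ Gamma r := fun x ⟨hx, h₁, h₂, h₃, h₄⟩ =>
    ⟨mem_cthickening_of_dist_le x p ε C (hC.corner_mem hr) (mem_ball.1 hx).le,
      mem_Gamma hr h₁ h₂ h₃ h₄⟩
  have hopen : IsOpen U := by
    refine isOpen_ball.inter ?_
    simp only [ofPred_and]
    exact (isOpen_lt (by fun_prop) (by fun_prop)).inter <|
      (isOpen_lt (by fun_prop) (by fun_prop)).inter <|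
      (isOpen_lt (by fun_prop) (by fun_prop)).inter (isOpen_lt (by fun_prop) (by fun_prop))
  have hne : U.Nonempty := by
    obtain ⟨t, ht, hlt⟩ := exists_between (lt_min (half_pos hε)
      (show 0 < 1 - 2 * r⁻¹ by linarith))
    obtain ⟨htε, htr⟩ := lt_min_iff.1 hlt
    have hpos : 0 < r⁻¹ := by positivity
    refine ⟨!₂[r⁻¹ + t, t], ?_, ?_⟩
    · rw [mem_ball, EuclideanSpace.dist_eq, Real.sqrt_lt' hε]
      simp [hp, Real.dist_eq]
      nlinarith
    · simp only [mem_ofPred_eq, Matrix.cons_val_zero, Matrix.cons_val_one]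
      exact ⟨by linarith, by linarith, ht, by linarith⟩
  exact (hopen.measure_pos volume hne).trans_le (measure_mono hsub)
end

section
/- Let r ≥ 30 be a real number. Then for every n ∈ ℕ, with ε = r^(−n), the area of the ε-parallel set of the Cantor dust C^r satisfies the upper bound λ²((C^r)_ε) < 4^n · r^(−2n) · (5 + π). -/
open MeasureTheory Metric Set Real Filter Topology ENNReal

lemma IsCantorDust.exists_eq_cantorMap {r : ℝ} {C : Set (EuclideanSpace ℝ (Fin 2))}
    (hC : IsCantorDust r C) {p : EuclideanSpace ℝ (Fin 2)} (hp : p ∈ C) :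
    ∃ q ∈ C, ∃ a b : ℝ, p = cantorMap r a b q ∧
      (a = 0 ∨ a = (r - 1) / r) ∧ (b = 0 ∨ b = (r - 1) / r) := by
  rw [hC.2.2] at hp
  rcases hp with ((⟨q, hq, rfl⟩ | ⟨q, hq, rfl⟩) | ⟨q, hq, rfl⟩) | ⟨q, hq, rfl⟩ <;>
    exact ⟨q, hq, _, _, rfl, by simp, by simp⟩

lemma IsCantorDust.exists_apply_eq {r : ℝ} (hr : r ≠ 0)
    {C : Set (EuclideanSpace ℝ (Fin 2))} (hC : IsCantorDust r C)
    {p : EuclideanSpace ℝ (Fin 2)} (hp : p ∈ C) (i : Fin 2) :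
    ∃ q ∈ C, p i = r⁻¹ * q i ∨ p i = r⁻¹ * q i + (1 - r⁻¹) := by
  have h : (r - 1) / r = 1 - r⁻¹ := by field_simp
  obtain ⟨q, hq, a, b, rfl, ha, hb⟩ := hC.exists_eq_cantorMap hp
  rw [h] at ha hb
  refine ⟨q, hq, ?_⟩
  fin_cases i
  · rcases ha with rfl | rfl <;> simp [cantorMap]
  · rcases hb with rfl | rfl <;> simp [cantorMap]

lemma IsCantorDust.apply_mem_Icc {r : ℝ} (hr : 1 < r) {C : Set (EuclideanSpace ℝ (Fin 2))}
    (hC : IsCantorDust r C) {p : EuclideanSpace ℝ (Fin 2)} (hp : p ∈ C) (i : Fin 2) :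
    p i ∈ Icc (0 : ℝ) 1 := by
  have hs0 : 0 < r⁻¹ := by positivity
  have hs1 : r⁻¹ < 1 := inv_lt_one_of_one_lt₀ hr
  have hcont : ContinuousOn (fun x : EuclideanSpace ℝ (Fin 2) => x i) C := by fun_prop
  obtain ⟨m, hm, hmin⟩ := hC.1.exists_isMinOn hC.2.1 hcont
  obtain ⟨M, hM, hmax⟩ := hC.1.exists_isMaxOn hC.2.1 hcont
  constructor
  · refine le_trans ?_ (hmin hp)
    obtain ⟨q, hq, h⟩ := hC.exists_apply_eq (by positivity) hm i
    have hle : m i ≤ q i := hmin hq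
    rcases h with h | h
    · change 0 ≤ m i
      nlinarith
    · change 0 ≤ m i
      nlinarith
  · refine (hmax hp).trans ?_
    obtain ⟨q, hq, h⟩ := hC.exists_apply_eq (by positivity) hM i
    have hle : q i ≤ M i := hmax hq
    rcases h with h | h
    · change M i ≤ 1
      nlinarith
    · change M i ≤ 1
      nlinarith

lemma IsCantorDust.apply_le_or_le_apply {r : ℝ} (hr : 1 < r)
    {C : Set (EuclideanSpace ℝ (Fin 2))} (hC : IsCantorDust r C)
    {p : EuclideanSpace ℝ (Fin 2)} (hp : p ∈ C) (i : Fin 2) :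
    p i ≤ r⁻¹ ∨ 1 - r⁻¹ ≤ p i := by
  have hs0 : 0 < r⁻¹ := by positivity
  obtain ⟨q, hq, h⟩ := hC.exists_apply_eq (by positivity) hp i
  obtain ⟨h0, h1⟩ := hC.apply_mem_Icc hr hq i
  rcases h with h | h
  · left; nlinarith
  · right; nlinarith

open scoped Pointwise in
lemma volume_cantorMap_image (r a b : ℝ) (A : Set (EuclideanSpace ℝ (Fin 2))) :
    volume (cantorMap r a b '' A) = ENNReal.ofReal (r⁻¹ ^ 2) * volume A := by
  have h : cantorMap r a b '' A =
      (fun x => x + (WithLp.equiv 2 (Fin 2 → ℝ)).symm ![a, b]) '' (r⁻¹ • A) := by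
    rw [← image_smul, image_image]
    rfl
  rw [h, image_add_right, measure_preimage_add_right, Measure.addHaar_smul]
  simp

lemma cthickening_image_cantorMap_subset {r : ℝ} (hr : 0 < r) (a b : ℝ) {δ : ℝ} (hδ : 0 ≤ δ)
    {C : Set (EuclideanSpace ℝ (Fin 2))} (hC : IsCompact C) :
    cthickening (r⁻¹ * δ) (cantorMap r a b '' C) ⊆ cantorMap r a b '' cthickening δ C := by
  have hcont : Continuous (cantorMap r a b) := by
    unfold cantorMap
    fun_prop
  rw [(hC.image hcont).cthickening_eq_biUnion_closedBall (by positivity)]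
  simp only [iUnion_subset_iff, forall_mem_image]
  intro q hq x hx
  set c := (WithLp.equiv 2 (Fin 2 → ℝ)).symm ![a, b] with hc
  have hx' : cantorMap r a b (r • (x - c)) = x := by
    simp [cantorMap, smul_smul, hr.ne', hc]
  refine ⟨r • (x - c), mem_cthickening_of_dist_le _ q _ _ hq ?_, hx'⟩
  rw [mem_closedBall, ← hx'] at hx
  simp only [cantorMap, dist_add_right, dist_smul₀, Real.norm_eq_abs,
    abs_of_pos (inv_pos.2 hr)] at hx
  exact le_of_mul_le_mul_left hx (inv_pos.2 hr)

lemma IsCantorDust.volume_cthickening_inv_mul_le {r : ℝ} (hr : 0 < r)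
    {C : Set (EuclideanSpace ℝ (Fin 2))} (hC : IsCantorDust r C) {δ : ℝ} (hδ : 0 ≤ δ) :
    volume (cthickening (r⁻¹ * δ) C) ≤
      4 * ENNReal.ofReal (r⁻¹ ^ 2) * volume (cthickening δ C) := by
  have key (a b : ℝ) : volume (cthickening (r⁻¹ * δ) (cantorMap r a b '' C)) ≤
      ENNReal.ofReal (r⁻¹ ^ 2) * volume (cthickening δ C) :=
    (measure_mono (cthickening_image_cantorMap_subset hr a b hδ hC.1)).trans_eq
      (volume_cantorMap_image ..)
  conv_lhs => rw [hC.2.2]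
  simp only [cthickening_union]
  calc _ ≤ _ := (measure_union_le _ _).trans (add_le_add ((measure_union_le _ _).trans
        (add_le_add ((measure_union_le _ _).trans (add_le_add (key _ _) (key _ _)))
          (key _ _))) (key _ _))
    _ = _ := by ring

lemma IsCantorDust.volume_cthickening_inv_pow_le {r : ℝ} (hr : 0 < r)
    {C : Set (EuclideanSpace ℝ (Fin 2))} (hC : IsCantorDust r C) (n : ℕ) :
    volume (cthickening (r⁻¹ ^ n) C) ≤
      (4 * ENNReal.ofReal (r⁻¹ ^ 2)) ^ n * volume (cthickening 1 C) := by
  induction n with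
  | zero => simp
  | succ n ih =>
    rw [pow_succ', pow_succ', mul_assoc]
    exact (hC.volume_cthickening_inv_mul_le hr (by positivity)).trans (by gcongr)

lemma volume_setOf_apply_mem_Icc (a b c d : ℝ) :
    volume {p : EuclideanSpace ℝ (Fin 2) | p 0 ∈ Icc a b ∧ p 1 ∈ Icc c d} =
      ENNReal.ofReal (b - a) * ENNReal.ofReal (d - c) := by
  have h : {p : EuclideanSpace ℝ (Fin 2) | p 0 ∈ Icc a b ∧ p 1 ∈ Icc c d} =
      WithLp.ofLp ⁻¹' (Icc ![a, c] ![b, d]) := by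
    ext p
    simp [Pi.le_def, Fin.forall_fin_two]
    tauto
  rw [h, (PiLp.volume_preserving_ofLp (Fin 2)).measure_preimage
    measurableSet_Icc.nullMeasurableSet, Real.volume_Icc_pi]
  simp

/-- The part of the closed unit disc in an open quadrant, the signs of `s` and `t` telling which. -/
def quarterDisc (s t : ℝ) : Set (EuclideanSpace ℝ (Fin 2)) :=
  {p | 0 < s * p 0 ∧ 0 < t * p 1 ∧ p 0 ^ 2 + p 1 ^ 2 ≤ 1}

lemma measurableSet_quarterDisc (s t : ℝ) : MeasurableSet (quarterDisc s t) := by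
  have h0 : Measurable fun p : EuclideanSpace ℝ (Fin 2) => p 0 := by fun_prop
  have h1 : Measurable fun p : EuclideanSpace ℝ (Fin 2) => p 1 := by fun_prop
  exact (measurableSet_lt measurable_const (h0.const_mul s)).inter
    ((measurableSet_lt measurable_const (h1.const_mul t)).inter
      (measurableSet_le ((h0.pow_const 2).add (h1.pow_const 2)) measurable_const))

lemma sum_volume_quarterDisc_le :
    volume (quarterDisc (-1) (-1)) + volume (quarterDisc (-1) 1) +
      volume (quarterDisc 1 (-1)) + volume (quarterDisc 1 1) ≤ ENNReal.ofReal π := by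
  rw [← measure_union _ (measurableSet_quarterDisc _ _),
    ← measure_union _ (measurableSet_quarterDisc _ _),
    ← measure_union _ (measurableSet_quarterDisc _ _)]
  · have hball : volume (closedBall (0 : EuclideanSpace ℝ (Fin 2)) 1) = ENNReal.ofReal π := by
      rw [EuclideanSpace.volume_closedBall_fin_two]
      simp
    rw [← hball]
    refine measure_mono fun p hp => ?_
    have h : p 0 ^ 2 + p 1 ^ 2 ≤ 1 := by
      rcases hp with ((hp | hp) | hp) | hp <;> exact hp.2.2
    rw [mem_closedBall, dist_zero_right, EuclideanSpace.norm_eq, Real.sqrt_le_one]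
    simpa using h
  all_goals
    rw [Set.disjoint_left]
    simp only [quarterDisc, mem_union, mem_ofPred_eq]
    intro p hp hq
    grind

lemma IsCantorDust.exists_sq_add_sq_le {r : ℝ} {C : Set (EuclideanSpace ℝ (Fin 2))}
    (hC : IsCantorDust r C) {p : EuclideanSpace ℝ (Fin 2)} (hp : p ∈ cthickening 1 C) :
    ∃ q ∈ C, (p 0 - q 0) ^ 2 + (p 1 - q 1) ^ 2 ≤ 1 := by
  rw [hC.1.cthickening_eq_biUnion_closedBall zero_le_one] at hp
  simp only [mem_iUnion, mem_closedBall] at hp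
  obtain ⟨q, hq, h⟩ := hp
  refine ⟨q, hq, ?_⟩
  rw [EuclideanSpace.dist_eq, Real.sqrt_le_one] at h
  simpa [Real.dist_eq, sq_abs] using h

/-- Above and below the unit square the `1`-parallel set stays in the obvious rectangles, and in
the strip around `x = 1 / 2` it keeps away from the line `y = 2`; at the corners it lies in
quarter discs. -/
lemma IsCantorDust.cthickening_one_subset {r : ℝ} (hr : 30 ≤ r)
    {C : Set (EuclideanSpace ℝ (Fin 2))} (hC : IsCantorDust r C) :
    cthickening 1 C ⊆
      ({p | p 0 ∈ Icc 0 (9 / 20) ∧ p 1 ∈ Icc (-1) 2} ∪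
        {p | p 0 ∈ Icc (9 / 20) (11 / 20) ∧ p 1 ∈ Icc (-1) (39 / 20)} ∪
        {p | p 0 ∈ Icc (11 / 20) 1 ∧ p 1 ∈ Icc (-1) 2} ∪
        {p | p 0 ∈ Icc (-1) 0 ∧ p 1 ∈ Icc 0 1} ∪
        {p | p 0 ∈ Icc 1 2 ∧ p 1 ∈ Icc 0 1}) ∪
      (quarterDisc (-1) (-1) ∪
        (fun p => p + WithLp.toLp 2 ![0, -1]) ⁻¹' quarterDisc (-1) 1 ∪
        (fun p => p + WithLp.toLp 2 ![-1, 0]) ⁻¹' quarterDisc 1 (-1) ∪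
        (fun p => p + WithLp.toLp 2 ![-1, -1]) ⁻¹' quarterDisc 1 1) := by
  intro p hp
  have hr1 : 1 < r := by linarith
  have hs : r⁻¹ ≤ 1 / 30 := by
    rw [one_div]
    exact inv_anti₀ (by norm_num) hr
  obtain ⟨q, hq, h⟩ := hC.exists_sq_add_sq_le hp
  obtain ⟨hx0, hx1⟩ := hC.apply_mem_Icc hr1 hq 0
  obtain ⟨hy0, hy1⟩ := hC.apply_mem_Icc hr1 hq 1
  have hgap := hC.apply_le_or_le_apply hr1 hq 0
  simp only [quarterDisc, mem_union, mem_ofPred_eq, mem_preimage, mem_Icc, PiLp.add_apply,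
    Matrix.cons_val_zero, Matrix.cons_val_one]
  generalize p 0 = x at *
  generalize p 1 = y at *
  generalize q 0 = u at *
  generalize q 1 = v at *
  have hxl : -1 ≤ x - u := by nlinarith
  have hxu : x - u ≤ 1 := by nlinarith
  have hyl : -1 ≤ y - v := by nlinarith
  have hyu : y - v ≤ 1 := by nlinarith
  have hstrip : 9 / 20 ≤ x → x ≤ 11 / 20 → y ≤ 39 / 20 := by
    intro h1 h2
    by_contra! h3
    have hy : (19 / 20) ^ 2 ≤ (y - v) ^ 2 := by gcongr; linarith
    have hx : (2 / 5) ^ 2 ≤ (x - u) ^ 2 := by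
      rcases hgap with hg | hg
      · gcongr; linarith
      · rw [← neg_sq (x - u)]; gcongr; linarith
    linarith
  rcases lt_or_ge x 0 with h1 | h1
  · have hx : x ^ 2 ≤ (x - u) ^ 2 := by nlinarith
    rcases lt_or_ge y 0 with h2 | h2
    · have hy : y ^ 2 ≤ (y - v) ^ 2 := by nlinarith
      right; left; left; left
      exact ⟨by linarith, by linarith, by linarith⟩
    rcases le_or_gt y 1 with h3 | h3
    · left; left; right
      exact ⟨⟨by linarith, by linarith⟩, by linarith, by linarith⟩
    · have hy : (y - 1) ^ 2 ≤ (y - v) ^ 2 := by gcongr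
      right; left; left; right
      exact ⟨by linarith, by linarith, by linarith⟩
  rcases le_or_gt x 1 with h4 | h4
  · left; left; left
    rcases le_or_gt x (9 / 20) with h5 | h5
    · left; left
      exact ⟨⟨by linarith, by linarith⟩, by linarith, by linarith⟩
    rcases le_or_gt x (11 / 20) with h6 | h6
    · left; right
      exact ⟨⟨by linarith, by linarith⟩, by linarith, hstrip h5.le h6⟩
    · right
      exact ⟨⟨by linarith, by linarith⟩, by linarith, by linarith⟩
  · have hx : (x - 1) ^ 2 ≤ (x - u) ^ 2 := by gcongr
    rcases lt_or_ge y 0 with h2 | h2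
    · have hy : y ^ 2 ≤ (y - v) ^ 2 := by nlinarith
      right; left; right
      exact ⟨by linarith, by linarith, by linarith⟩
    rcases le_or_gt y 1 with h3 | h3
    · left; right
      exact ⟨⟨by linarith, by linarith⟩, by linarith, by linarith⟩
    · have hy : (y - 1) ^ 2 ≤ (y - v) ^ 2 := by gcongr
      right; right
      exact ⟨by linarith, by linarith, by linarith⟩

lemma IsCantorDust.volume_cthickening_one_lt {r : ℝ} (hr : 30 ≤ r)
    {C : Set (EuclideanSpace ℝ (Fin 2))} (hC : IsCantorDust r C) :
    volume (cthickening 1 C) < ENNReal.ofReal (5 + π) := by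
  calc volume (cthickening 1 C)
      ≤ _ := (measure_mono (hC.cthickening_one_subset hr)).trans
        ((measure_union_le _ _).trans (add_le_add
          ((measure_union_le _ _).trans (add_le_add_left ((measure_union_le _ _).trans
            (add_le_add_left ((measure_union_le _ _).trans (add_le_add_left
              (measure_union_le _ _) _)) _)) _))
          ((measure_union_le _ _).trans (add_le_add_left ((measure_union_le _ _).trans
            (add_le_add_left (measure_union_le _ _) _)) _))))
    _ ≤ ENNReal.ofReal (999 / 200) + ENNReal.ofReal π := by
        simp only [measure_preimage_add_right, volume_setOf_apply_mem_Icc]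
        refine add_le_add (le_of_eq ?_) sum_volume_quarterDisc_le
        rw [← ENNReal.ofReal_mul (by norm_num), ← ENNReal.ofReal_mul (by norm_num),
          ← ENNReal.ofReal_mul (by norm_num), ← ENNReal.ofReal_mul (by norm_num),
          ← ENNReal.ofReal_mul (by norm_num), ← ENNReal.ofReal_add (by norm_num) (by norm_num),
          ← ENNReal.ofReal_add (by norm_num) (by norm_num),
          ← ENNReal.ofReal_add (by norm_num) (by norm_num),
          ← ENNReal.ofReal_add (by norm_num) (by norm_num)]
        norm_num
    _ < ENNReal.ofReal (5 + π) := by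
        rw [← ENNReal.ofReal_add (by norm_num) Real.pi_pos.le,
          ENNReal.ofReal_lt_ofReal_iff (by positivity)]
        linarith

/-- For `r ≥ 30` and every `n ∈ ℕ`, with `ε = r^(-n)`,
`λ²((C^r)_ε) < 4^n · r^(-2n) · (5 + π)`. -/
theorem stmt_6 (r : ℝ) (hr : 30 ≤ r) (C : Set (EuclideanSpace ℝ (Fin 2)))
    (hC : IsCantorDust r C) (n : ℕ) :
    (volume (cthickening (r ^ (-(n : ℝ))) C)).toReal <
      4 ^ n * r ^ (-(2 * (n : ℝ))) * (5 + π) := by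
  have hr0 : 0 < r := by linarith
  have hlt := hC.volume_cthickening_one_lt hr
  have hfin : volume (cthickening 1 C) ≠ ⊤ := hlt.ne_top
  have hone : (volume (cthickening 1 C)).toReal < 5 + π :=
    (ENNReal.lt_ofReal_iff_toReal_lt hfin).1 hlt
  have hε : r ^ (-(n : ℝ)) = r⁻¹ ^ n := by
    rw [Real.rpow_neg hr0.le, Real.rpow_natCast, inv_pow]
  have hε2 : r ^ (-(2 * (n : ℝ))) = (r⁻¹ ^ 2) ^ n := by
    rw [Real.rpow_neg hr0.le, ← Nat.cast_ofNat, ← Nat.cast_mul, Real.rpow_natCast, ← pow_mul,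
      inv_pow]
  rw [hε, hε2]
  calc (volume (cthickening (r⁻¹ ^ n) C)).toReal
      ≤ ((4 * ENNReal.ofReal (r⁻¹ ^ 2)) ^ n * volume (cthickening 1 C)).toReal :=
        ENNReal.toReal_mono
          (ENNReal.mul_ne_top (ENNReal.pow_ne_top (by finiteness)) hfin)
          (hC.volume_cthickening_inv_pow_le hr0 n)
    _ = 4 ^ n * (r⁻¹ ^ 2) ^ n * (volume (cthickening 1 C)).toReal := by
        rw [ENNReal.toReal_mul, ENNReal.toReal_pow, ENNReal.toReal_mul,
          ENNReal.toReal_ofReal (by positivity), mul_pow]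
        norm_num
    _ < 4 ^ n * (r⁻¹ ^ 2) ^ n * (5 + π) := by gcongr
end
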